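/- The Isaacs condition holds: for every p ∈ ℝ^J, sup_{u∈U} inf_{m∈M} H(p,u,m) = inf_{m∈M} sup_{u∈U} H(p,u,m). -/

import Mathlib

open Real

noncomputable section

/-- Euclidean dot product on `ℝ^J`. -/
def dotJ {J : ℕ} (p q : Fin J → ℝ) : ℝ := ∑ j, p j * q j

/-- `γ_i = e_i − e_{i+1}` for `i < J`, and `γ_J = e_J` (0-indexed). -/
def gam (J : ℕ) (i : Fin J) : Fin J → ℝ :=
  fun j => (if j = i then (1 : ℝ) else 0) - (if (j : ℕ) = (i : ℕ) + 1 then (1 : ℝ) else 0)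

/-- `b_i = β_i (e_1 + ⋯ + e_i)` (0-indexed: coordinates `j ≤ i`). -/
def bvec {J : ℕ} (β : Fin J → ℝ) (i : Fin J) : Fin J → ℝ :=
  fun j => if (j : ℕ) ≤ (i : ℕ) then β i else 0

/-- The domain `G`. -/
def domG {J : ℕ} [NeZero J] (z : Fin J → ℝ) : Set (Fin J → ℝ) :=
  {x | (∀ i, 0 ≤ x i) ∧ x 0 < z 0 ∧ ∀ i : Fin J, i ≠ 0 → x i ≤ z i}

/-- The boundary portion `∂_o G`. -/
def bdO {J : ℕ} [NeZero J] (z : Fin J → ℝ) : Set (Fin J → ℝ) :=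
  {x | x 0 = z 0 ∧ ∀ i : Fin J, i ≠ 0 → 0 ≤ x i ∧ x i ≤ z i}

/-- The boundary portion `∂_c G`. -/
def bdC {J : ℕ} [NeZero J] (z : Fin J → ℝ) : Set (Fin J → ℝ) :=
  {x | x ∈ domG z ∧ ∃ i : Fin J, i ≠ 0 ∧ x i = z i}

/-- The Hamiltonian `H(p) = c + λ(1 − e^{−p_1}) + Σ_i max(0, μ_i(1 − e^{γ_i·p}))`. -/
def Ham {J : ℕ} [NeZero J] (lam c : ℝ) (μ : Fin J → ℝ) (p : Fin J → ℝ) : ℝ :=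
  c + lam * (1 - Real.exp (-(p 0))) +
    ∑ i, max 0 (μ i * (1 - Real.exp (dotJ (gam J i) p)))

/-- Superdifferential of `V` at `x`, relative to the set `G`. -/
def supDiff {J : ℕ} (G : Set (Fin J → ℝ)) (V : (Fin J → ℝ) → ℝ) (x : Fin J → ℝ) :
    Set (Fin J → ℝ) :=
  {p | ∀ ε > 0, ∃ r > 0, ∀ y ∈ G, ‖y - x‖ < r →
    V y - V x - dotJ p (y - x) ≤ ε * ‖y - x‖}

/-- Subdifferential of `V` at `x`, relative to the set `G`. -/
def subDiff {J : ℕ} (G : Set (Fin J → ℝ)) (V : (Fin J → ℝ) → ℝ) (x : Fin J → ℝ) :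
    Set (Fin J → ℝ) :=
  {p | ∀ ε > 0, ∃ r > 0, ∀ y ∈ G, ‖y - x‖ < r →
    -(ε * ‖y - x‖) ≤ V y - V x - dotJ p (y - x)}

/-- `A' = {i : μ_i ≤ μ_j for all j < i}`. -/
def Aprime {J : ℕ} (μ : Fin J → ℝ) : Set (Fin J) := {i | ∀ j, j < i → μ i ≤ μ j}

/-- `A(x) = {i ∈ A' : i+1 ∉ B(x), or every j > i with [i+1,j] ⊆ B(x) has μ_i < μ_j}`. -/
def Aset {J : ℕ} (μ z x : Fin J → ℝ) : Set (Fin J) :=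
  {i | i ∈ Aprime μ ∧
    ((∀ h : (i : ℕ) + 1 < J, x ⟨(i : ℕ) + 1, h⟩ ≠ z ⟨(i : ℕ) + 1, h⟩) ∨
      ∀ j : Fin J, i < j → (∀ k : Fin J, i < k → k ≤ j → x k = z k) → μ i < μ j)}

/-- `l(x) = x log x − x + 1` (finite branch; `Real.log 0 = 0` gives `0·log 0 = 0`). -/
def lfun (x : ℝ) : ℝ := x * Real.log x - x + 1

/-- The control set `U = [0,1]^J`. -/
def Uset (J : ℕ) : Set (Fin J → ℝ) := {u | ∀ i, 0 ≤ u i ∧ u i ≤ 1}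

/-- The perturbation set `M = {(λ̄, μ̄) : λ̄ ≥ 0, μ̄_i ≥ 0}`. -/
def Mset (J : ℕ) : Set (ℝ × (Fin J → ℝ)) := {m | 0 ≤ m.1 ∧ ∀ i, 0 ≤ m.2 i}

/-- `H(p,u,m) = c + p·(λ̄ e_1 − Σ_i u_i μ̄_i γ_i) + λ l(λ̄/λ) + Σ_i u_i μ_i l(μ̄_i/μ_i)`. -/
def Hpum {J : ℕ} [NeZero J] (lam c : ℝ) (μ : Fin J → ℝ) (p u : Fin J → ℝ)
    (m : ℝ × (Fin J → ℝ)) : ℝ :=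
  c + dotJ p (fun j => m.1 * (if j = 0 then 1 else 0) - ∑ i, u i * m.2 i * gam J i j)
    + lam * lfun (m.1 / lam) + ∑ i, u i * (μ i * lfun (m.2 i / μ i))

/-- `h(ν,δ) = c + λ(1 − e^{Σ_i ν_i β_i − δ_1}) + Σ_i μ_i(1 − e^{−ν_i β_i + δ_i − δ_{i+1}})`,
with `ν ∈ ℝ^J` and `δ ∈ ℝ^{J+1}`. -/
def hFun {J : ℕ} (lam c : ℝ) (μ β : Fin J → ℝ)
    (q : (Fin J → ℝ) × (Fin (J + 1) → ℝ)) : ℝ :=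
  c + lam * (1 - Real.exp (∑ i, q.1 i * β i - q.2 0)) +
    ∑ i : Fin J, μ i * (1 - Real.exp (-(q.1 i * β i) + q.2 i.castSucc - q.2 i.succ))

/-- The constraint set `S` of pairs `(ν, δ)`. -/
def Sset {J : ℕ} (μ β z x : Fin J → ℝ) :
    Set ((Fin J → ℝ) × (Fin (J + 1) → ℝ)) :=
  {q | q.2 (Fin.last J) = 0 ∧
    (∀ i : Fin J, x i = 0 → 0 ≤ q.2 i.castSucc) ∧
    (∀ i : Fin J, x i = z i → q.2 i.castSucc ≤ 0) ∧
    (∀ i : Fin J, x i ≠ 0 → x i ≠ z i → q.2 i.castSucc = 0) ∧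
    (∀ i ∈ Aset μ z x, 0 ≤ q.1 i) ∧
    (∀ i ∉ Aset μ z x, q.1 i = 0) ∧
    (∑ i, q.1 i) = 1 ∧
    ∀ i : Fin J, -(q.1 i * β i) + q.2 i.castSucc - q.2 i.succ ≤ 0}

/-- `s` = largest (1-indexed) `j ≤ k` with `j ∉ I(x)`, and `s = 0` if none exists. -/
def sIdx {J : ℕ} (x : Fin J → ℝ) (k : Fin J) : ℕ :=
  sSup (insert 0 ((fun j : Fin J => (j : ℕ) + 1) '' {j | j ≤ k ∧ x j ≠ 0}))

/-- `t` = least (1-indexed) `j ∈ [k+1, J]` with `j ∉ B(x)`, and `t = J+1` if none exists. -/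
def tIdx {J : ℕ} (z x : Fin J → ℝ) (k : Fin J) : ℕ :=
  sInf (insert (J + 1) ((fun j : Fin J => (j : ℕ) + 1) '' {j | k < j ∧ x j ≠ z j}))

/-- `δ^{(r,k)}_i = β_k (1_{i ≥ r+1} − 1_{i ≥ k+1})` (1-indexed `i`, `r`; coordinates of
`Fin (J+1)` are the 1-indexed positions shifted by one). -/
def delrk {J : ℕ} (β : Fin J → ℝ) (k : Fin J) (r : ℕ) : Fin (J + 1) → ℝ :=
  fun i => β k * ((if r ≤ (i : ℕ) then 1 else 0) - (if (k : ℕ) + 1 ≤ (i : ℕ) then 1 else 0))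

lemma lfun_lower (m a x : ℝ) (hm : 0 < m) (hx : 0 ≤ x) :
    m * (1 - Real.exp a) ≤ -a * x + m * lfun (x / m) := by
  obtain ⟨y, rfl⟩ : ∃ y, x = m * y := ⟨x / m, by field_simp⟩
  have hy : 0 ≤ y := by
    by_contra h
    push Not at h
    nlinarith
  rw [mul_div_cancel_left₀ _ hm.ne']
  have key : y * (1 + a - Real.log y) ≤ Real.exp a := by
    rcases hy.eq_or_lt with h | h
    · rw [← h, zero_mul]
      exact (Real.exp_pos a).le
    · have h1 := Real.add_one_le_exp (a - Real.log y)
      have h2 : Real.exp a = y * Real.exp (a - Real.log y) := by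
        rw [Real.exp_sub, Real.exp_log h]
        field_simp
      rw [h2]
      exact mul_le_mul_of_nonneg_left (by linarith) hy
  unfold lfun
  nlinarith [mul_le_mul_of_nonneg_left key hm.le]

lemma lfun_attain (m a : ℝ) (hm : 0 < m) :
    -a * (m * Real.exp a) + m * lfun (m * Real.exp a / m) = m * (1 - Real.exp a) := by
  rw [mul_div_cancel_left₀ _ hm.ne']
  unfold lfun
  rw [Real.log_exp]
  ring

lemma Hpum_eq {J : ℕ} [NeZero J] (lam c : ℝ) (μ : Fin J → ℝ) (p u : Fin J → ℝ)
    (m : ℝ × (Fin J → ℝ)) :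
    Hpum lam c μ p u m = c + (p 0 * m.1 + lam * lfun (m.1 / lam))
      + ∑ i, u i * (-(dotJ p (gam J i)) * m.2 i + μ i * lfun (m.2 i / μ i)) := by
  have h : dotJ p (fun j => m.1 * (if j = 0 then 1 else 0) - ∑ i, u i * m.2 i * gam J i j)
      = p 0 * m.1 - ∑ i, u i * (dotJ p (gam J i) * m.2 i) := by
    simp only [dotJ, mul_sub, Finset.sum_sub_distrib]
    congr 1
    · simp
    · simp only [Finset.mul_sum, Finset.sum_mul]
      rw [Finset.sum_comm]
      refine Finset.sum_congr rfl fun i _ => Finset.sum_congr rfl fun j _ => ?_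
      ring
  unfold Hpum
  rw [h]
  have h2 : ∑ i, u i * (-(dotJ p (gam J i)) * m.2 i + μ i * lfun (m.2 i / μ i))
      = -∑ i, u i * (dotJ p (gam J i) * m.2 i) + ∑ i, u i * (μ i * lfun (m.2 i / μ i)) := by
    rw [← Finset.sum_neg_distrib, ← Finset.sum_add_distrib]
    refine Finset.sum_congr rfl fun i _ => ?_
    ring
  rw [h2]
  ring

/-- the Isaacs condition
`sup_{u∈U} inf_{m∈M} H(p,u,m) = inf_{m∈M} sup_{u∈U} H(p,u,m)`. -/
theorem stmt9 (J : ℕ) [NeZero J] (lam c : ℝ) (μ : Fin J → ℝ)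
    (hlam : 0 < lam) (hc : 0 < c) (hμ : ∀ i, 0 < μ i) (p : Fin J → ℝ) :
    sSup ((fun u => sInf ((fun m => Hpum lam c μ p u m) '' Mset J)) '' Uset J) =
    sInf ((fun m => sSup ((fun u => Hpum lam c μ p u m) '' Uset J)) '' Mset J) := by
  set a : Fin J → ℝ := fun i => dotJ p (gam J i) with ha
  set ms : ℝ × (Fin J → ℝ) := (lam * Real.exp (-(p 0)), fun i => μ i * Real.exp (a i)) with hms
  set us : Fin J → ℝ := fun i => if a i ≤ 0 then 1 else 0 with hus
  have hmsM : ms ∈ Mset J :=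
    ⟨mul_nonneg hlam.le (Real.exp_pos _).le,
      fun i => mul_nonneg (hμ i).le (Real.exp_pos _).le⟩
  have husU : us ∈ Uset J := by
    intro i
    simp only [hus]
    split_ifs <;> norm_num
  have hval : ∀ u, Hpum lam c μ p u ms
      = c + lam * (1 - Real.exp (-(p 0))) + ∑ i, u i * (μ i * (1 - Real.exp (a i))) := by
    intro u
    rw [Hpum_eq]
    have h1 := lfun_attain lam (-(p 0)) hlam
    rw [neg_neg] at h1
    simp only [hms]
    rw [h1]
    congr 1
    exact Finset.sum_congr rfl fun i _ => by rw [lfun_attain _ _ (hμ i)]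
  have hmin : ∀ u ∈ Uset J, ∀ m ∈ Mset J, Hpum lam c μ p u ms ≤ Hpum lam c μ p u m := by
    intro u hu m hm
    rw [hval, Hpum_eq]
    have h1 := lfun_lower lam (-(p 0)) m.1 hlam hm.1
    rw [neg_neg] at h1
    have h2 : ∑ i, u i * (μ i * (1 - Real.exp (a i))) ≤
        ∑ i, u i * (-(dotJ p (gam J i)) * m.2 i + μ i * lfun (m.2 i / μ i)) :=
      Finset.sum_le_sum fun i _ =>
        mul_le_mul_of_nonneg_left (lfun_lower _ _ _ (hμ i) (hm.2 i)) (hu i).1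
    linarith
  have hmax : ∀ u ∈ Uset J, Hpum lam c μ p u ms ≤ Hpum lam c μ p us ms := by
    intro u hu
    rw [hval, hval]
    refine add_le_add le_rfl (Finset.sum_le_sum fun i _ => ?_)
    simp only [hus]
    split_ifs with h
    · have h3 : 0 ≤ μ i * (1 - Real.exp (a i)) :=
        mul_nonneg (hμ i).le (by linarith [Real.exp_le_one_iff.2 h])
      nlinarith [(hu i).2]
    · push Not at h
      have h3 : 0 ≤ μ i * (Real.exp (a i) - 1) :=
        mul_nonneg (hμ i).le (by linarith [Real.one_lt_exp_iff.2 h])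
      nlinarith [mul_nonneg (hu i).1 h3]
  have hbdd : ∀ m, BddAbove ((fun u => Hpum lam c μ p u m) '' Uset J) := by
    intro m
    refine ⟨c + (p 0 * m.1 + lam * lfun (m.1 / lam))
      + ∑ i, |(-(dotJ p (gam J i)) * m.2 i + μ i * lfun (m.2 i / μ i))|, ?_⟩
    rintro _ ⟨u, hu, rfl⟩
    simp only [Hpum_eq]
    gcongr with i _
    refine (mul_le_mul_of_nonneg_left (le_abs_self _) (hu i).1).trans ?_
    exact mul_le_of_le_one_left (abs_nonneg _) (hu i).2
  have hinf : ∀ u ∈ Uset J,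
      sInf ((fun m => Hpum lam c μ p u m) '' Mset J) = Hpum lam c μ p u ms := by
    intro u hu
    refine IsLeast.csInf_eq ⟨⟨ms, hmsM, rfl⟩, ?_⟩
    rintro _ ⟨m, hm, rfl⟩
    exact hmin u hu m hm
  have hL : IsGreatest ((fun u => sInf ((fun m => Hpum lam c μ p u m) '' Mset J)) '' Uset J)
      (Hpum lam c μ p us ms) := by
    refine ⟨⟨us, husU, hinf us husU⟩, ?_⟩
    rintro _ ⟨u, hu, rfl⟩
    simp only
    rw [hinf u hu]
    exact hmax u hu
  have hR : IsLeast ((fun m => sSup ((fun u => Hpum lam c μ p u m) '' Uset J)) '' Mset J)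
      (Hpum lam c μ p us ms) := by
    refine ⟨⟨ms, hmsM, IsGreatest.csSup_eq ⟨⟨us, husU, rfl⟩, ?_⟩⟩, ?_⟩
    · rintro _ ⟨u, hu, rfl⟩
      exact hmax u hu
    · rintro _ ⟨m, hm, rfl⟩
      exact (hmin us husU m hm).trans (le_csSup (hbdd m) ⟨us, husU, rfl⟩)
  rw [hL.csSup_eq, hR.csInf_eq]
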